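/- Let Φ be a root system, G a group, and {X_α}_{α∈Φ} a family of subgroups of G satisfying the grading condition. Fix f ∈ F(Φ) and set G_f = ⟨X_α : α ∈ Φ_f⟩. Let E_f be the (finite) collection of Borel subsets Φ_g of Φ with Φ_g ≠ Φ_f and Φ_g ∩ Φ_f ≠ ∅, and for Φ_g ∈ E_f set G_{f,g} = ⟨X_α : α ∈ Φ_f ∩ Φ_g⟩. Then for every unitary representation H of G_f with no nonzero G_f-invariant vectors and every choice of vectors v_g ∈ H^{G_{f,g}} (one for each Φ_g ∈ E_f), one has ‖Σ_{Φ_g ∈ E_f} v_g‖² ≤ (|E_f|/2)·Σ_{Φ_g ∈ E_f} ‖v_g‖²; in particular, the codistance between the subspaces {H^{G_{f,g}} : Φ_g ∈ E_f} is at most 1/2. -/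

import Mathlib

section RootSystemDefs

variable {E : Type*} [AddCommGroup E] [Module ℝ E]

/-- A root system in a real vector space `E`: a finite subset that spans `E`,
does not contain `0`, and is closed under negation. -/
structure IsRootSystem (Φ : Set E) : Prop where
  finite : Φ.Finite
  spans : Submodule.span ℝ Φ = ⊤
  zero_notMem : (0 : E) ∉ Φ
  neg_mem : ∀ α ∈ Φ, -α ∈ Φ

/-- `f ∈ F(Φ)`: a linear functional not vanishing on any root and taking
distinct values on distinct roots. -/
def IsRegularFunc (Φ : Set E) (f : E →ₗ[ℝ] ℝ) : Prop :=
  (∀ α ∈ Φ, f α ≠ 0) ∧ ∀ α ∈ Φ, ∀ β ∈ Φ, α ≠ β → f α ≠ f β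

/-- The Borel set `Φ_f = {α ∈ Φ | f α > 0}`. -/
def borelSet (Φ : Set E) (f : E →ₗ[ℝ] ℝ) : Set E :=
  {α ∈ Φ | 0 < f α}

/-- A Borel subset of `Φ`. -/
def IsBorelSet (Φ : Set E) (B : Set E) : Prop :=
  ∃ f : E →ₗ[ℝ] ℝ, IsRegularFunc Φ f ∧ B = borelSet Φ f

/-- Two Borel sets `B₁`, `B₂` are co-maximal if every Borel set containing
`B₁ ∩ B₂` equals `B₁` or `B₂`. -/
def CoMaximal (Φ : Set E) (B₁ B₂ : Set E) : Prop :=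
  ∀ B : Set E, IsBorelSet Φ B → B₁ ∩ B₂ ⊆ B → B = B₁ ∨ B = B₂

/-- The boundary of the Borel set `Φ_f`. -/
def borelBoundary (Φ : Set E) (f : E →ₗ[ℝ] ℝ) : Set E :=
  ⋃ B ∈ {B : Set E | IsBorelSet Φ B ∧ CoMaximal Φ (borelSet Φ f) B}, borelSet Φ f \ B

/-- The core of the Borel set `Φ_f`. -/
def borelCore (Φ : Set E) (f : E →ₗ[ℝ] ℝ) : Set E :=
  borelSet Φ f \ borelBoundary Φ f

/-- `Ψ` is a subsystem of `Φ` if `Ψ = Φ ∩ span ℝ Ψ`. -/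
def IsSubsystem (Φ Ψ : Set E) : Prop :=
  Ψ = Φ ∩ (Submodule.span ℝ Ψ : Set E)

/-- Irreducibility of a root system. -/
def IsIrreducibleRS (Φ : Set E) : Prop :=
  ¬ ∃ Φ₁ Φ₂ : Set E, Φ₁.Nonempty ∧ Φ₂.Nonempty ∧ Φ₁ ∪ Φ₂ = Φ ∧ Disjoint Φ₁ Φ₂ ∧
      Submodule.span ℝ Φ₁ ⊓ Submodule.span ℝ Φ₂ = ⊥

/-- The rank of a subset of `E` (the dimension of its span). -/
noncomputable def rankOf (Ψ : Set E) : ℕ := Module.finrank ℝ (Submodule.span ℝ Ψ)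

/-- Regularity of a root system: every root lies in an irreducible rank-2 subsystem. -/
def IsRegularRS (Φ : Set E) : Prop :=
  ∀ α ∈ Φ, ∃ Ψ : Set E, IsSubsystem Φ Ψ ∧ IsIrreducibleRS Ψ ∧ rankOf Ψ = 2 ∧ α ∈ Ψ

end RootSystemDefs

section GradingDefs

variable {E : Type*} [AddCommGroup E] [Module ℝ E] {G : Type*} [Group G]

/-- The grading condition: for roots `α, β` with `α ∉ ℝ_{<0}·β`, the commutator
`[X_α, X_β]` lies in the subgroup generated by the root subgroups `X_γ` with
`γ = aα + bβ ∈ Φ`, `a, b ≥ 1`. -/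
def GradingCond (Φ : Set E) (X : E → Subgroup G) : Prop :=
  ∀ α ∈ Φ, ∀ β ∈ Φ, (¬ ∃ c : ℝ, c < 0 ∧ α = c • β) →
    ⁅X α, X β⁆ ≤ ⨆ γ ∈ {γ ∈ Φ | ∃ a b : ℝ, 1 ≤ a ∧ 1 ≤ b ∧ γ = a • α + b • β}, X γ

/-- `{X_α}` is a `Φ`-grading of `G`: the grading condition holds and the root
subgroups generate `G`. -/
def IsGrading (Φ : Set E) (X : E → Subgroup G) : Prop :=
  GradingCond Φ X ∧ (⨆ α ∈ Φ, X α) = ⊤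

/-- The grading is strong: for every regular functional `f` and every `γ` in the
core `C_f`, the root subgroup `X_γ` is contained in the subgroup generated by the
`X_β` with `β ∈ Φ_f`, `β ∉ ℝγ`. -/
def IsStrong (Φ : Set E) (X : E → Subgroup G) : Prop :=
  ∀ f : E →ₗ[ℝ] ℝ, IsRegularFunc Φ f → ∀ γ ∈ borelCore Φ f,
    X γ ≤ ⨆ β ∈ {β ∈ borelSet Φ f | ¬ ∃ c : ℝ, β = c • γ}, X β

/-- The grading is `k`-strong: for every irreducible subsystem `Ψ` of rank `k`,
the family `{X_α}_{α ∈ Ψ}` is a strong `Ψ`-grading of the subgroup it generates. -/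
def IsKStrong (Φ : Set E) (X : E → Subgroup G) (k : ℕ) : Prop :=
  ∀ Ψ : Set E, IsSubsystem Φ Ψ → IsIrreducibleRS Ψ → rankOf Ψ = k →
    GradingCond Ψ X ∧ IsStrong Ψ X

end GradingDefs

section Helpers

variable {E : Type*} [AddCommGroup E] [Module ℝ E] {G : Type*} [Group G]
  {H : Type*} [NormedAddCommGroup H] [InnerProductSpace ℂ H]

/-- The subspace of vectors fixed by the elements of `Gf` lying in `K`. -/
def fixSub {Gf : Subgroup G} (ρ : Gf →* (H ≃ₗᵢ[ℂ] H)) (K : Subgroup G) : Submodule ℂ H where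
  carrier := {w | ∀ g : Gf, (g : G) ∈ K → ρ g w = w}
  add_mem' := by
    intro a b ha hb g hg
    rw [map_add, ha g hg, hb g hg]
  zero_mem' := by
    intro g hg
    exact map_zero _
  smul_mem' := by
    intro c a ha g hg
    rw [map_smul, ha g hg]

theorem mem_fixSub {Gf : Subgroup G} (ρ : Gf →* (H ≃ₗᵢ[ℂ] H)) (K : Subgroup G) (w : H) :
    w ∈ fixSub ρ K ↔ ∀ g : Gf, (g : G) ∈ K → ρ g w = w := Iff.rfl

theorem isClosed_fixSub {Gf : Subgroup G} (ρ : Gf →* (H ≃ₗᵢ[ℂ] H)) (K : Subgroup G) :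
    IsClosed (fixSub ρ K : Set H) := by
  have : (fixSub ρ K : Set H) = ⋂ (g : Gf) (_ : (g : G) ∈ K), {w | ρ g w = w} := by
    ext w
    simp [mem_fixSub]
  rw [this]
  refine isClosed_iInter fun g => isClosed_iInter fun _ => ?_
  exact isClosed_eq (ρ g).continuous continuous_id

/-- The stabilizer of a vector, as a subgroup of `G`. -/
def stabSub {Gf : Subgroup G} (ρ : Gf →* (H ≃ₗᵢ[ℂ] H)) (w : H) : Subgroup G :=
  Subgroup.map Gf.subtype
    { carrier := {g | ρ g w = w}
      mul_mem' := by
        intro a b ha hb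
        change ρ (a * b) w = w
        rw [map_mul]
        change ρ a (ρ b w) = w
        rw [show ρ b w = w from hb, show ρ a w = w from ha]
      one_mem' := by
        change ρ 1 w = w
        rw [map_one]
        rfl
      inv_mem' := by
        intro a ha
        change ρ a⁻¹ w = w
        have h1 : ρ a⁻¹ (ρ a w) = w := by
          change (ρ a⁻¹ * ρ a) w = w
          rw [← map_mul, inv_mul_cancel, map_one]
          rfl
        rwa [show ρ a w = w from ha] at h1 }

theorem mem_fixSub_iff {Gf : Subgroup G} (ρ : Gf →* (H ≃ₗᵢ[ℂ] H)) (K : Subgroup G)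
    (hK : K ≤ Gf) (w : H) : w ∈ fixSub ρ K ↔ K ≤ stabSub ρ w := by
  constructor
  · intro h k hk
    exact ⟨⟨k, hK hk⟩, h ⟨k, hK hk⟩ hk, rfl⟩
  · intro h g hg
    obtain ⟨g', hg', he⟩ := h hg
    have : g' = g := Subtype.ext he
    subst this
    exact hg'

theorem fixSub_invariant {Gf : Subgroup G} (ρ : Gf →* (H ≃ₗᵢ[ℂ] H)) (K : Subgroup G)
    (hn : ∀ h ∈ Gf, ∀ k ∈ K, h * k * h⁻¹ ∈ K) (h : Gf) (w : H) (hw : w ∈ fixSub ρ K) :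
    ρ h w ∈ fixSub ρ K := by
  intro g hg
  have h1 : ρ (h⁻¹ * g * h) w = w := by
    apply hw
    have := hn (h : G)⁻¹ (Gf.inv_mem h.2) g hg
    simpa using this
  have h2 : ρ g (ρ h w) = ρ h (ρ (h⁻¹ * g * h) w) := by
    change (ρ g * ρ h) w = (ρ h * ρ (h⁻¹ * g * h)) w
    rw [← map_mul, ← map_mul]
    congr 2
    group
  rw [h2, h1]

theorem proj_comm {Gf : Subgroup G} (ρ : Gf →* (H ≃ₗᵢ[ℂ] H)) (V : Submodule ℂ H)
    [V.HasOrthogonalProjection]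
    (hV : ∀ (h : Gf) (w : H), w ∈ V → ρ h w ∈ V) (h : Gf) (x : H) :
    V.starProjection (ρ h x) = ρ h (V.starProjection x) := by
  apply Submodule.eq_starProjection_of_mem_of_inner_eq_zero
  · exact hV _ _ (Submodule.starProjection_apply_mem V x)
  · intro w hw
    rw [← map_sub]
    have h1 : w = ρ h (ρ h⁻¹ w) := by
      change w = (ρ h * ρ h⁻¹) w
      rw [← map_mul, mul_inv_cancel, map_one]
      rfl
    rw [h1, LinearIsometryEquiv.inner_map_map]
    exact Submodule.starProjection_inner_eq_zero x _ (hV _ _ hw)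

theorem conj_mem_upper (Φ : Set E) (X : E → Subgroup G) (hX : GradingCond Φ X)
    (f : E →ₗ[ℝ] ℝ) (T : Set E) (hT : T ⊆ borelSet Φ f)
    (hup : ∀ α ∈ T, ∀ β ∈ borelSet Φ f, f α ≤ f β → β ∈ T) :
    ∀ h ∈ (⨆ α ∈ borelSet Φ f, X α), ∀ k ∈ (⨆ α ∈ T, X α : Subgroup G),
      h * k * h⁻¹ ∈ (⨆ α ∈ T, X α : Subgroup G) := by
  set N : Subgroup G := ⨆ α ∈ T, X α with hN
  have key : ∀ α ∈ borelSet Φ f, ∀ x ∈ X α, ∀ k ∈ N, x * k * x⁻¹ ∈ N := by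
    intro α hα x hx
    have : N ≤ N.comap (MulAut.conj x).toMonoidHom := by
      refine iSup₂_le fun β hβ y hy => ?_
      change x * y * x⁻¹ ∈ N
      have hyN : y ∈ N := (le_iSup₂ (f := fun α (_ : α ∈ T) => X α) β hβ) hy
      have hc : x * y * x⁻¹ * y⁻¹ ∈ N := by
        have hβ' := hT hβ
        have h1 := hX α hα.1 β hβ'.1 (by
          rintro ⟨c, hc, he⟩
          have h2 := hα.2
          rw [he, map_smul, smul_eq_mul] at h2
          nlinarith [hβ'.2])
        have h2 := h1 (Subgroup.commutator_mem_commutator hx hy)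
        refine (iSup₂_le ?_ : _ ≤ N) h2
        rintro γ ⟨hγ, a, b, ha, hb, rfl⟩
        have hα2 := hα.2
        have hβ2 := hβ'.2
        have hle : f β ≤ f (a • α + b • β) := by
          simp only [map_add, map_smul, smul_eq_mul]
          nlinarith
        exact le_iSup₂ (f := fun α (_ : α ∈ T) => X α) _
          (hup β hβ _ ⟨hγ, lt_of_lt_of_le hβ2 hle⟩ hle)
      have : x * y * x⁻¹ = x * y * x⁻¹ * y⁻¹ * y := by
        group
      rw [this]
      exact N.mul_mem hc hyN
    intro k hk
    exact this hk
  have hle : (⨆ α ∈ borelSet Φ f, X α) ≤ Subgroup.normalizer (N : Set G) := by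
    refine iSup₂_le fun α hα x hx => ?_
    rw [Subgroup.mem_normalizer_iff]
    intro k
    constructor
    · exact key α hα x hx k
    · intro h
      have := key α hα x⁻¹ ((X α).inv_mem hx) _ h
      simpa [mul_assoc] using this
  intro h hh k hk
  exact (Subgroup.mem_normalizer_iff.1 (hle hh) k).1 hk

theorem count_half (Φ : Set E) (hΦ : IsRootSystem Φ) (f : E →ₗ[ℝ] ℝ)
    (𝔅 : Finset (Set E))
    (h𝔅 : ∀ B : Set E,
      B ∈ 𝔅 ↔ IsBorelSet Φ B ∧ B ≠ borelSet Φ f ∧ (B ∩ borelSet Φ f).Nonempty)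
    (α : E) (hα : α ∈ borelSet Φ f) [DecidablePred fun B : Set E => α ∉ B] :
    2 * (𝔅.filter (fun B => α ∉ B)).card ≤ 𝔅.card := by
  classical
  have hsub : ∀ B ∈ 𝔅, B ⊆ Φ := by
    intro B hB
    obtain ⟨⟨g, hg, rfl⟩, -⟩ := (h𝔅 B).1 hB
    exact fun x hx => hx.1
  have h1 : (𝔅.filter (fun B => α ∉ B)).card ≤ (𝔅.filter (fun B => ¬ α ∉ B)).card := by
    refine Finset.card_le_card_of_injOn (fun B => Φ \ B) ?_ ?_
    · intro B hB
      have hB := Finset.mem_filter.1 hB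
      obtain ⟨hB, hαB⟩ := hB
      apply Finset.mem_coe.2
      refine Finset.mem_filter.2 ⟨?_, fun h => h ⟨hα.1, hαB⟩⟩
      obtain ⟨⟨g, hg, rfl⟩, hne, x, hx1, hx2⟩ := (h𝔅 B).1 hB
      refine (h𝔅 _).2 ⟨⟨-g, ⟨?_, ?_⟩, ?_⟩, ?_, ?_⟩
      · intro β hβ
        simpa using hg.1 β hβ
      · intro β hβ γ hγ hne
        simpa using hg.2 β hβ γ hγ hne
      · ext β
        simp only [borelSet, Set.mem_diff, Set.mem_setOf_eq, LinearMap.neg_apply]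
        constructor
        · rintro ⟨h1, h2⟩
          refine ⟨h1, ?_⟩
          have := hg.1 β h1
          have h3 : ¬ 0 < g β := fun h => h2 ⟨h1, h⟩
          have := lt_of_le_of_ne (not_lt.1 h3) this
          linarith
        · rintro ⟨h1, h2⟩
          exact ⟨h1, fun h => by linarith [h.2]⟩
      · intro h
        rw [← h] at hx2
        exact hx2.2 hx1
      · exact ⟨α, ⟨hα.1, hαB⟩, hα⟩
    · intro B hB C hC h
      have hB' := hsub B (Finset.mem_filter.1 hB).1
      have hC' := hsub C (Finset.mem_filter.1 hC).1
      have h : Φ \ B = Φ \ C := h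
      rw [← Set.sdiff_sdiff_cancel_left hB', h, Set.sdiff_sdiff_cancel_left hC']
  have h2 := Finset.card_filter_add_card_filter_not (s := 𝔅) (fun B => α ∉ B)
  omega

theorem norm_sum_half {ι : Type*} (s t : Finset ι) (hst : t ⊆ s) (hc : 2 * t.card ≤ s.card)
    (w : ι → H) (hw : ∀ i ∈ s, i ∉ t → w i = 0) :
    ‖∑ i ∈ s, w i‖ ^ 2 ≤ ((s.card : ℝ) / 2) * ∑ i ∈ s, ‖w i‖ ^ 2 := by
  have h1 : ∑ i ∈ s, w i = ∑ i ∈ t, w i := (Finset.sum_subset hst hw).symm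
  have h2 : ∑ i ∈ s, ‖w i‖ ^ 2 = ∑ i ∈ t, ‖w i‖ ^ 2 :=
    (Finset.sum_subset hst (fun i hi hi' => by simp [hw i hi hi'])).symm
  rw [h1, h2]
  have h3 : ‖∑ i ∈ t, w i‖ ^ 2 ≤ (∑ i ∈ t, ‖w i‖) ^ 2 := by
    gcongr
    exact norm_sum_le _ _
  have h4 : (∑ i ∈ t, ‖w i‖) ^ 2 ≤ t.card * ∑ i ∈ t, ‖w i‖ ^ 2 := sq_sum_le_card_mul_sum_sq
  refine h3.trans (h4.trans ?_)
  gcongr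
  have : (2 : ℝ) * t.card ≤ s.card := by exact_mod_cast hc
  linarith

theorem pyth (V : Submodule ℂ H) (a b : H) (ha : a ∈ V) (hb : b ∈ Vᗮ) :
    ‖a + b‖ ^ 2 = ‖a‖ ^ 2 + ‖b‖ ^ 2 := by
  have := norm_add_sq_eq_norm_sq_add_norm_sq_of_inner_eq_zero a b (𝕜 := ℂ) (hb a ha)
  simpa [sq] using this

theorem main_induction [CompleteSpace H] (Φ : Set E) (hΦ : IsRootSystem Φ)
    (X : E → Subgroup G) (hX : GradingCond Φ X)
    (f : E →ₗ[ℝ] ℝ) (hf : IsRegularFunc Φ f)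
    (Gf : Subgroup G) (hGf : Gf = ⨆ α ∈ borelSet Φ f, X α)
    (𝔅 : Finset (Set E))
    (h𝔅 : ∀ B : Set E,
      B ∈ 𝔅 ↔ IsBorelSet Φ B ∧ B ≠ borelSet Φ f ∧ (B ∩ borelSet Φ f).Nonempty)
    (ρ : Gf →* (H ≃ₗᵢ[ℂ] H))
    (hnoinv : ∀ w : H, (∀ g : Gf, ρ g w = w) → w = 0) (n : ℕ) :
    ∀ T : Set E, T ⊆ borelSet Φ f →
      (∀ α ∈ T, ∀ β ∈ borelSet Φ f, f α ≤ f β → β ∈ T) →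
      (borelSet Φ f \ T).ncard = n →
      ∀ v : Set E → H,
      (∀ B ∈ 𝔅, v B ∈ fixSub ρ (⨆ α ∈ borelSet Φ f ∩ B, X α)) →
      (∀ B ∈ 𝔅, v B ∈ fixSub ρ (⨆ α ∈ T, X α)) →
      ‖∑ B ∈ 𝔅, v B‖ ^ 2 ≤ ((𝔅.card : ℝ) / 2) * ∑ B ∈ 𝔅, ‖v B‖ ^ 2 := by
  classical
  have hfin : (borelSet Φ f).Finite := hΦ.finite.subset (fun x hx => hx.1)
  have hleGf : ∀ T : Set E, T ⊆ borelSet Φ f → (⨆ α ∈ T, X α) ≤ Gf := by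
    intro T hT
    rw [hGf]
    exact biSup_mono hT
  induction n with
  | zero =>
    intro T hT hup hcard v hv hvT
    have hTe : T = borelSet Φ f := by
      rw [Set.ncard_eq_zero (hfin.subset Set.diff_subset)] at hcard
      exact Set.Subset.antisymm hT (Set.diff_eq_empty.1 hcard)
    have h0 : ∀ B ∈ 𝔅, v B = 0 := by
      intro B hB
      apply hnoinv
      intro g
      apply hvT B hB g
      rw [hTe, ← hGf]
      exact g.2
    rw [Finset.sum_eq_zero h0]
    simp only [norm_zero, ne_eq, OfNat.ofNat_ne_zero, not_false_eq_true, zero_pow]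
    positivity
  | succ n ih =>
    intro T hT hup hcard v hv hvT
    have hdf : (borelSet Φ f \ T).Finite := hfin.subset Set.diff_subset
    have hne : (borelSet Φ f \ T).Nonempty := by
      rw [← Set.ncard_pos hdf]
      omega
    obtain ⟨α, hα, hmax⟩ := Set.exists_max_image _ f hdf hne
    have hT' : insert α T ⊆ borelSet Φ f := Set.insert_subset hα.1 hT
    have hup' : ∀ γ ∈ insert α T, ∀ β ∈ borelSet Φ f, f γ ≤ f β → β ∈ insert α T := by
      intro γ hγ β hβ hle
      rcases hγ with rfl | hγ
      · by_cases hβT : β ∈ T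
        · exact Or.inr hβT
        · left
          by_contra hne
          exact hf.2 β hβ.1 γ hα.1.1 hne (le_antisymm (hmax β ⟨hβ, hβT⟩) hle)
      · exact Or.inr (hup γ hγ β hβ hle)
    have hcard' : (borelSet Φ f \ insert α T).ncard = n := by
      have h1 : borelSet Φ f \ insert α T = (borelSet Φ f \ T) \ {α} := by
        ext x
        simp only [Set.mem_diff, Set.mem_insert_iff, Set.mem_singleton_iff]
        tauto
      rw [h1, Set.ncard_diff_singleton_of_mem hα, hcard]
      rfl
    set V := fixSub ρ (⨆ β ∈ insert α T, X β) with hV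
    haveI : CompleteSpace V := (isClosed_fixSub ρ _).completeSpace_coe
    have hinv : ∀ (h : Gf) (w : H), w ∈ V → ρ h w ∈ V := by
      refine fixSub_invariant ρ _ ?_
      intro h hh
      rw [hGf] at hh
      exact conj_mem_upper Φ X hX f _ hT' hup' h hh
    have hP : ∀ (K : Subgroup G) (w : H), w ∈ fixSub ρ K → V.starProjection w ∈ fixSub ρ K := by
      intro K w hw g hg
      rw [← proj_comm ρ V hinv, hw g hg]
    set p : Set E → H := fun B => V.starProjection (v B) with hp
    set q : Set E → H := fun B => v B - p B with hq
    have hpV : ∀ B, p B ∈ V := fun B => Submodule.starProjection_apply_mem V _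
    have hqV : ∀ B, q B ∈ Vᗮ := fun B => Submodule.sub_starProjection_mem_orthogonal _
    have hpq : ∀ B, v B = p B + q B := fun B => by simp [hq]
    have hI := ih (insert α T) hT' hup' hcard' p (fun B hB => hP _ _ (hv B hB))
      (fun B hB => hpV B)
    have hJ : ‖∑ B ∈ 𝔅, q B‖ ^ 2 ≤ ((𝔅.card : ℝ) / 2) * ∑ B ∈ 𝔅, ‖q B‖ ^ 2 := by
      refine norm_sum_half 𝔅 (𝔅.filter (fun B => α ∉ B)) (Finset.filter_subset _ _)
        (count_half Φ hΦ f 𝔅 h𝔅 α hα.1) q ?_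
      intro B hB hBn
      have hαB : α ∈ B := by
        by_contra h
        exact hBn (Finset.mem_filter.2 ⟨hB, h⟩)
      have hq1 : q B ∈ fixSub ρ (⨆ α ∈ borelSet Φ f ∩ B, X α) :=
        Submodule.sub_mem _ (hv B hB) (hP _ _ (hv B hB))
      have hq2 : q B ∈ fixSub ρ (⨆ α ∈ T, X α) :=
        Submodule.sub_mem _ (hvT B hB) (hP _ _ (hvT B hB))
      have hqm : q B ∈ V := by
        rw [hV, mem_fixSub_iff ρ _ (hleGf _ hT')]
        rw [mem_fixSub_iff ρ _ (hleGf _ Set.inter_subset_left)] at hq1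
        rw [mem_fixSub_iff ρ _ (hleGf _ hT)] at hq2
        rw [iSup_insert]
        refine sup_le (le_trans ?_ hq1) hq2
        exact le_iSup₂ (f := fun α (_ : α ∈ borelSet Φ f ∩ B) => X α) α ⟨hα.1, hαB⟩
      exact inner_self_eq_zero.1 (hqV B (q B) hqm)
    have hs : ∑ B ∈ 𝔅, v B = ∑ B ∈ 𝔅, p B + ∑ B ∈ 𝔅, q B := by
      rw [← Finset.sum_add_distrib]
      exact Finset.sum_congr rfl (fun B _ => hpq B)
    have hn : ∑ B ∈ 𝔅, ‖v B‖ ^ 2 = ∑ B ∈ 𝔅, ‖p B‖ ^ 2 + ∑ B ∈ 𝔅, ‖q B‖ ^ 2 := by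
      rw [← Finset.sum_add_distrib]
      refine Finset.sum_congr rfl (fun B _ => ?_)
      rw [hpq B]
      exact pyth V _ _ (hpV B) (hqV B)
    rw [hs, hn, pyth V _ _ (Submodule.sum_mem _ fun B _ => hpV B)
      (Submodule.sum_mem _ fun B _ => hqV B), mul_add]
    exact add_le_add hI hJ

end Helpers

/-- Theorem 5.5(a): let `{X_α}` satisfy the grading condition, `f ∈ F(Φ)`,
`G_f = ⟨X_α : α ∈ Φ_f⟩`, and let `𝔅` (the edge set `E_f`) be the finite collection
of Borel sets `B ≠ Φ_f` with `B ∩ Φ_f ≠ ∅`; for such `B` put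
`G_{f,B} = ⟨X_α : α ∈ Φ_f ∩ B⟩`.  Then for any unitary representation `H` of `G_f`
without nonzero invariant vectors and vectors `v B ∈ H^{G_{f,B}}`, one has
`‖Σ v_B‖² ≤ (|E_f|/2)·Σ ‖v_B‖²`, i.e. the codistance between the subspaces
`H^{G_{f,B}}` is at most `1/2`. -/
theorem statement9 {E : Type*} [AddCommGroup E] [Module ℝ E] [FiniteDimensional ℝ E]
    (Φ : Set E) (hΦ : IsRootSystem Φ)
    {G : Type*} [Group G] (X : E → Subgroup G) (hX : GradingCond Φ X)
    (f : E →ₗ[ℝ] ℝ) (hf : IsRegularFunc Φ f)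
    (Gf : Subgroup G) (hGf : Gf = ⨆ α ∈ borelSet Φ f, X α)
    (𝔅 : Finset (Set E))
    (h𝔅 : ∀ B : Set E,
      B ∈ 𝔅 ↔ IsBorelSet Φ B ∧ B ≠ borelSet Φ f ∧ (B ∩ borelSet Φ f).Nonempty)
    (H : Type*) [NormedAddCommGroup H] [InnerProductSpace ℂ H] [CompleteSpace H]
    (ρ : Gf →* (H ≃ₗᵢ[ℂ] H))
    (hnoinv : ∀ w : H, (∀ g : Gf, ρ g w = w) → w = 0)
    (v : Set E → H)
    (hv : ∀ B ∈ 𝔅, ∀ g : Gf,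
      (g : G) ∈ (⨆ α ∈ borelSet Φ f ∩ B, X α : Subgroup G) → ρ g (v B) = v B) :
    ‖∑ B ∈ 𝔅, v B‖ ^ 2 ≤ ((𝔅.card : ℝ) / 2) * ∑ B ∈ 𝔅, ‖v B‖ ^ 2 := by
  refine main_induction Φ hΦ X hX f hf Gf hGf 𝔅 h𝔅 ρ hnoinv _ ∅ (Set.empty_subset _)
    (fun α hα => absurd hα (Set.notMem_empty α)) rfl v hv ?_
  intro B hB g hg
  have h1 : (g : G) = 1 := by simpa using hg
  have h2 : g = 1 := Subtype.ext h1
  rw [h2, map_one]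
  rfl
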